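/- arXiv:2006.06765 — 3 statements merged into one kernel-verified Lean document; each statement's English description precedes it below -/
import Mathlib

section
/- Let $a_1,\dots,a_5$ be nonzero integers with $S=\sum_{i=1}^5 a_i$, let $\mathcal{P}=\{i\mid a_i>0\}$ and $\mathcal{N}=\{i\mid a_i<0\}$, and suppose both $\mathcal{P}$ and $\mathcal{N}$ are nonempty. If $\sum_{i\in\mathcal{P}}a_i^2\le S^2$ and $\sum_{i\in\mathcal{N}}a_i^2\le S^2$, then $\sum_{i=1}^5 a_i^3\ne S^3$. -/
open Finset

/-- If the sum of squares over a finset is at most `t²`, then the sum of cubes is at most `|t|³`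
in absolute value. -/
theorem abs_sum_cubes_le_of_sum_sq_le {ι : Type*} (s : Finset ι) (f : ι → ℤ) (t : ℤ)
    (h : ∑ i ∈ s, (f i) ^ 2 ≤ t ^ 2) : |∑ i ∈ s, (f i) ^ 3| ≤ |t| ^ 3 := by
  have hf : ∀ i ∈ s, |f i| ≤ |t| := fun i hi =>
    sq_le_sq.mp ((single_le_sum (f := fun j => (f j) ^ 2) (fun j _ => sq_nonneg _) hi).trans h)
  calc |∑ i ∈ s, (f i) ^ 3| ≤ ∑ i ∈ s, |(f i) ^ 3| := abs_sum_le_sum_abs _ _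
    _ ≤ ∑ i ∈ s, |t| * (f i) ^ 2 := sum_le_sum fun i hi => by
        rw [abs_pow, ← sq_abs (f i), pow_succ' |f i| 2]
        exact mul_le_mul_of_nonneg_right (hf i hi) (sq_nonneg _)
    _ = |t| * ∑ i ∈ s, (f i) ^ 2 := (mul_sum _ _ _).symm
    _ ≤ |t| * t ^ 2 := mul_le_mul_of_nonneg_left h (abs_nonneg _)
    _ = |t| ^ 3 := by rw [← sq_abs t, ← pow_succ']

/-- Let `a₁,…,a₅` be nonzero integers with sum `S`, with at least one positive and
at least one negative. If both the sum of squares over the positive indices and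
the sum of squares over the negative indices are at most `S²`, then `∑ aᵢ³ ≠ S³`. -/
theorem sum_cubes_ne (a : Fin 5 → ℤ) (ha : ∀ i, a i ≠ 0)
    (hpos : ∃ i, 0 < a i) (hneg : ∃ i, a i < 0)
    (hP : ∑ i ∈ univ.filter (fun i => 0 < a i), (a i)^2 ≤ (∑ i, a i)^2)
    (hN : ∑ i ∈ univ.filter (fun i => a i < 0), (a i)^2 ≤ (∑ i, a i)^2) :
    ∑ i, (a i)^3 ≠ (∑ i, a i)^3 := by
  have hsplit : ∑ i, (a i) ^ 3 = ∑ i ∈ univ.filter (fun i => 0 < a i), (a i) ^ 3 +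
      ∑ i ∈ univ.filter (fun i => a i < 0), (a i) ^ 3 := by
    rw [← sum_filter_add_sum_filter_not univ (fun i => 0 < a i)]
    congr 2
    ext i
    have := ha i
    simp only [mem_filter, mem_univ, true_and]
    omega
  have hPpos : 0 < ∑ i ∈ univ.filter (fun i => 0 < a i), (a i) ^ 3 := by
    obtain ⟨i, hi⟩ := hpos
    exact sum_pos (fun j hj => pow_pos (mem_filter.mp hj).2 3) ⟨i, by simpa using hi⟩
  have hNneg : ∑ i ∈ univ.filter (fun i => a i < 0), (a i) ^ 3 < 0 := by
    obtain ⟨i, hi⟩ := hneg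
    exact sum_neg (fun j hj => Odd.pow_neg (by decide) (mem_filter.mp hj).2)
      ⟨i, by simpa using hi⟩
  have hPle := abs_le.mp (abs_sum_cubes_le_of_sum_sq_le _ _ _ hP)
  have hNle := abs_le.mp (abs_sum_cubes_le_of_sum_sq_le _ _ _ hN)
  have hlt : |∑ i, (a i) ^ 3| < |∑ i, a i| ^ 3 := by
    rw [hsplit, abs_lt]
    constructor <;> linarith [hPle.2, hNle.1]
  intro h
  rw [h, abs_pow] at hlt
  exact lt_irrefl _ hlt
end

section
/- Let $a_1,\dots,a_5$ be nonzero integers, at least one positive and at least one negative, with $S=\sum_{i=1}^5 a_i$. If $\sum_{i=1}^5 a_i^2=S^2+4$ and $\sum_{i=1}^5 a_i^3=S^3$, then at least one of the following holds: (i) $S^2\le 4$; (ii) every positive $a_i$ equals $1$; (iii) every negative $a_i$ equals $-1$. -/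
open Finset

/-- If `∑ aᵢ² = S² + 4` and `∑ aᵢ³ = S³` with `S > 0`, no three of the `aᵢ` are negative. -/
lemma not_three_neg {v w x y z : ℤ} (hv : v < 0) (hw : w < 0) (hx : x < 0)
    (hS : 0 < v + w + x + y + z)
    (hsq : v ^ 2 + w ^ 2 + x ^ 2 + y ^ 2 + z ^ 2 = (v + w + x + y + z) ^ 2 + 4)
    (hcube : v ^ 3 + w ^ 3 + x ^ 3 + y ^ 3 + z ^ 3 = (v + w + x + y + z) ^ 3) : False := by
  obtain ⟨S, hSdef⟩ : ∃ S, S = v + w + x + y + z := ⟨_, rfl⟩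
  rw [← hSdef] at hS hsq hcube
  obtain rfl : z = S - v - w - x - y := by linarith
  -- the left factor is the second divided difference of `∏ (t - aᵢ)` at `v, w, x`
  have hdiv : 6 * ((v ^ 3 + w ^ 3 + x ^ 3 + v ^ 2 * w + v ^ 2 * x + w ^ 2 * v + w ^ 2 * x
        + x ^ 2 * v + x ^ 2 * w + v * w * x)
      - S * (v ^ 2 + w ^ 2 + x ^ 2 + v * w + v * x + w * x) - 2 * (v + w + x) + 2 * S) = 0 := by
    linear_combination 2 * hcube + 3 * (v + w + x - S) * hsq
  obtain ⟨b, rfl⟩ : ∃ b, v = -b := ⟨-v, by ring⟩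
  obtain ⟨c, rfl⟩ : ∃ c, w = -c := ⟨-w, by ring⟩
  obtain ⟨d, rfl⟩ : ∃ d, x = -d := ⟨-x, by ring⟩
  have hb : 0 < b := by linarith
  have hc : 0 < c := by linarith
  have hd : 0 < d := by linarith
  have h1 : 1 ≤ b * c := mul_pos hb hc
  have h2 : 1 ≤ b * d := mul_pos hb hd
  have h3 : 1 ≤ c * d := mul_pos hc hd
  have hquad : 0 < S * (b ^ 2 + c ^ 2 + d ^ 2 + (b * c - 1) + (b * d - 1) + c * d) :=
    mul_pos hS (by nlinarith)
  have hcub : 0 ≤ (b + c + d) * (b * c + b * d + c * d - 3) :=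
    mul_nonneg (by linarith) (by linarith)
  have : 0 ≤ b ^ 3 + c ^ 3 + d ^ 3 := by positivity
  have : 0 < b * c * d := by positivity
  nlinarith

/-- If `∑ aᵢ² = S² + 4` and `∑ aᵢ³ = S³`, and four of the `aᵢ` are positive, the fifth is at least
`-1`; here it is written `-n`. -/
lemma le_one_of_four_pos {n w x y z : ℤ} (hw : 0 < w) (hx : 0 < x) (hy : 0 < y) (hz : 0 < z)
    (hsq : n ^ 2 + w ^ 2 + x ^ 2 + y ^ 2 + z ^ 2 = (-n + w + x + y + z) ^ 2 + 4)
    (hcube : -n ^ 3 + w ^ 3 + x ^ 3 + y ^ 3 + z ^ 3 = (-n + w + x + y + z) ^ 3) : n ≤ 1 := by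
  by_contra! hn
  obtain ⟨P, hP⟩ : ∃ P, P = w + x + y + z := ⟨_, rfl⟩
  obtain ⟨Q, hQ⟩ : ∃ Q, Q = w * x + w * y + w * z + x * y + x * z + y * z := ⟨_, rfl⟩
  obtain ⟨R, hR⟩ : ∃ R, R = w * x * y + w * x * z + w * y * z + x * y * z := ⟨_, rfl⟩
  have hQP : Q = n * P - 2 := by subst hP hQ; linarith
  have hRP : R = (n ^ 2 - 2) * P := by
    have : 6 * R = 6 * ((n ^ 2 - 2) * P) := by
      subst hP hQ hR
      linear_combination 2 * hcube - 3 * (-n + w + x + y + z) * hsq + 6 * n * hQP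
    linarith
  have hnewton : 2 * (P * R) ≤ Q ^ 2 := by
    subst hP hQ hR
    nlinarith [sq_nonneg (w * x - y * z), sq_nonneg (w * y), sq_nonneg (w * z),
      sq_nonneg (x * y), sq_nonneg (x * z)]
  have hP4 : 4 ≤ P := by omega
  rw [hRP, hQP] at hnewton
  nlinarith [mul_pos (by linarith : 0 < n) (by linarith : 0 < P),
    mul_nonneg (mul_nonneg (by linarith : 0 ≤ n - 2) (by linarith : 0 ≤ n + 2)) (sq_nonneg P)]

/-- If `∑ aᵢ² = S² + 4` and `∑ aᵢ³ = S³` with `S ≥ 3`, and exactly two of the `aᵢ` are negative,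
they are `-1` and `-1`; here they are written `-m` and `-n`. -/
lemma add_le_two_of_three_pos {m n x y z : ℤ} (hm : 0 < m) (hn : 0 < n)
    (hS : 3 ≤ -m + -n + x + y + z)
    (hsq : m ^ 2 + n ^ 2 + x ^ 2 + y ^ 2 + z ^ 2 = (-m + -n + x + y + z) ^ 2 + 4)
    (hcube : -m ^ 3 + -n ^ 3 + x ^ 3 + y ^ 3 + z ^ 3 = (-m + -n + x + y + z) ^ 3) :
    m + n ≤ 2 := by
  by_contra! hmn
  obtain ⟨P, hP⟩ : ∃ P, P = x + y + z := ⟨_, rfl⟩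
  obtain ⟨Q, hQ⟩ : ∃ Q, Q = x * y + x * z + y * z := ⟨_, rfl⟩
  obtain ⟨R, hR⟩ : ∃ R, R = x * y * z := ⟨_, rfl⟩
  obtain ⟨s, hs⟩ : ∃ s, s = m + n := ⟨_, rfl⟩
  obtain ⟨q, hq⟩ : ∃ q, q = m * n := ⟨_, rfl⟩
  have hQP : Q = s * P - q - 2 := by subst hP hQ hs hq; linarith
  have hRP : R = (s ^ 2 - q - 2) * P - s * q := by
    have : 6 * R = 6 * ((s ^ 2 - q - 2) * P - s * q) := by
      subst hP hQ hR hs hq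
      linear_combination 2 * hcube - 3 * (-m + -n + x + y + z) * hsq + 6 * (m + n) * hQP
    linarith
  have hnewton : 3 * (P * R) ≤ Q ^ 2 := by
    subst hP hQ hR
    nlinarith [sq_nonneg (x * y - x * z), sq_nonneg (x * y - y * z), sq_nonneg (x * z - y * z)]
  have hsP : s + 3 ≤ P := by linarith
  have hs3 : 3 ≤ s := by omega
  have hq4 : 4 * q ≤ s ^ 2 := by subst hs hq; nlinarith [sq_nonneg (m - n)]
  have hq0 : 0 < q := hq ▸ mul_pos hm hn
  rw [hRP, hQP] at hnewton
  have key : (2 * s ^ 2 - 3 * q - 6) * P ^ 2 - s * (q - 4) * P - (q + 2) ^ 2 ≤ 0 := by linarith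
  obtain ⟨d, rfl⟩ : ∃ d, P = s + d := ⟨P - s, by ring⟩
  have hss : 9 ≤ s ^ 2 := by nlinarith
  have hconst : 0 < 2 * s ^ 4 - 4 * q * s ^ 2 - 2 * s ^ 2 - (q + 2) ^ 2 := by nlinarith
  have hlin : 0 ≤ s * d * (4 * s ^ 2 - 7 * q - 8) :=
    mul_nonneg (mul_nonneg (by linarith) (by linarith)) (by linarith)
  have hquad : 0 ≤ (2 * s ^ 2 - 3 * q - 6) * d ^ 2 := mul_nonneg (by linarith) (sq_nonneg d)
  linarith

lemma neg_one_le_of_monotone {a : Fin 5 → ℤ} (hmono : Monotone a) (ha : ∀ i, a i ≠ 0)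
    (hS : 3 ≤ ∑ i, a i) (hsq : ∑ i, (a i) ^ 2 = (∑ i, a i) ^ 2 + 4)
    (hcube : ∑ i, (a i) ^ 3 = (∑ i, a i) ^ 3) (i : Fin 5) : -1 ≤ a i := by
  have h01 : a 0 ≤ a 1 := hmono (by decide)
  have h12 : a 1 ≤ a 2 := hmono (by decide)
  have h23 : a 2 ≤ a 3 := hmono (by decide)
  have h34 : a 3 ≤ a 4 := hmono (by decide)
  refine le_trans ?_ (hmono (Fin.zero_le i))
  simp only [Fin.sum_univ_five] at hS hsq hcube
  have h1 := ha 1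
  have h2 := ha 2
  rcases lt_or_gt_of_ne h2 with h2 | h2
  · exact (not_three_neg (by omega) (by omega) h2 (by omega) hsq hcube).elim
  rcases lt_or_gt_of_ne h1 with h1 | h1
  · have := add_le_two_of_three_pos (m := -a 0) (n := -a 1) (x := a 2) (y := a 3) (z := a 4)
      (by omega) (by omega) (by linarith) (by linarith) (by ring_nf at hcube ⊢; linarith)
    omega
  · have := le_one_of_four_pos (n := -a 0) h1 h2 (by omega : 0 < a 3) (by omega : 0 < a 4)
      (by linarith) (by ring_nf at hcube ⊢; linarith)
    omega

lemma neg_one_le_of_three_le_sum {a : Fin 5 → ℤ} (ha : ∀ i, a i ≠ 0)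
    (hS : 3 ≤ ∑ i, a i) (hsq : ∑ i, (a i) ^ 2 = (∑ i, a i) ^ 2 + 4)
    (hcube : ∑ i, (a i) ^ 3 = (∑ i, a i) ^ 3) (i : Fin 5) : -1 ≤ a i := by
  have hsum (f : Fin 5 → ℤ) : ∑ i, f (Tuple.sort a i) = ∑ i, f i := Equiv.sum_comp _ f
  have h := neg_one_le_of_monotone (Tuple.monotone_sort a) (fun i => ha _)
    ((hsum a).symm ▸ hS)
    ((hsum (a · ^ 2)).trans (hsq.trans (by rw [← hsum a]; rfl)))
    ((hsum (a · ^ 3)).trans (hcube.trans (by rw [← hsum a]; rfl))) ((Tuple.sort a).symm i)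
  simpa using h

/-- Let `a₁,…,a₅` be nonzero integers, at least one positive and one negative,
with sum `S`. If `∑ aᵢ² = S² + 4` and `∑ aᵢ³ = S³`, then either `S² ≤ 4`, or
every positive `aᵢ` equals `1`, or every negative `aᵢ` equals `-1`. -/
theorem pretzel_trichotomy (a : Fin 5 → ℤ) (ha : ∀ i, a i ≠ 0)
    (hpos : ∃ i, 0 < a i) (hneg : ∃ i, a i < 0)
    (hsq : ∑ i, (a i)^2 = (∑ i, a i)^2 + 4)
    (hcube : ∑ i, (a i)^3 = (∑ i, a i)^3) :
    (∑ i, a i)^2 ≤ 4 ∨ (∀ i, 0 < a i → a i = 1) ∨ (∀ i, a i < 0 → a i = -1) := by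
  rcases le_or_gt 3 (∑ i, a i) with h | h
  · refine Or.inr (Or.inr fun i hi => ?_)
    have := neg_one_le_of_three_le_sum ha h hsq hcube i
    omega
  rcases le_or_gt (∑ i, a i) (-3) with h' | h'
  · refine Or.inr (Or.inl fun i hi => ?_)
    have := neg_one_le_of_three_le_sum (a := fun i => -a i) (fun i => neg_ne_zero.mpr (ha i))
      (by rw [sum_neg_distrib]; linarith) (by simpa [sum_neg_distrib] using hsq)
      (by simpa [sum_neg_distrib, Odd.neg_pow (by decide : Odd 3)] using hcube) i
    omega
  · left
    nlinarith
end

section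
/- Let $a_1,\dots,a_5$ be odd integers such that exactly two or exactly three of them are negative (and the rest positive), and let $S=\sum_{i=1}^5 a_i$. If $\sum_{i=1}^5 a_i^2=S^2+4$ and $\sum_{i=1}^5 a_i^3=S^3$, then either $\sum_{i=1}^5 a_i^2\le 8$, or there exist indices $i,j$ with $a_i=1$ and $a_j=-1$. -/
open Finset

/-- The case of a positive sum: then the largest entry equals the sum, so the other four
entries have sum `0` and sum of squares `4`, which forces two of them to be `1` and two `-1`. -/
theorem exists_one_and_neg_one_of_sum_pos (a : Fin 5 → ℤ) (hodd : ∀ i, Odd (a i))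
    (hsq : ∑ i, (a i)^2 = (∑ i, a i)^2 + 4)
    (hcube : ∑ i, (a i)^3 = (∑ i, a i)^3) (hpos : 0 < ∑ i, a i) :
    ∃ i j, a i = 1 ∧ a j = -1 := by
  obtain ⟨k, hk⟩ := Finite.exists_max a
  have hbpos : 0 < a k := by
    by_contra! h
    exact absurd (Finset.sum_nonpos fun i _ => (hk i).trans h) (not_le.mpr hpos)
  have one_le_sq : ∀ i, 1 ≤ (a i)^2 := fun i =>
    (sq_pos_of_ne_zero fun h => by simpa [h] using hodd i : 0 < (a i)^2)
  rw [Fin.sum_univ_succAbove _ k, Fin.sum_univ_succAbove a k] at hsq hcube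
  rw [Fin.sum_univ_succAbove a k] at hpos
  have hodd' := fun j => hodd (k.succAbove j)
  have hle := fun j => hk (k.succAbove j)
  have hone := fun j => one_le_sq (k.succAbove j)
  suffices h : ∃ i j, a (k.succAbove i) = 1 ∧ a (k.succAbove j) = -1 by
    obtain ⟨i, j, h⟩ := h
    exact ⟨_, _, h⟩
  generalize a k = b at *
  generalize hx : (fun j => a (k.succAbove j)) = x
  have hx' : ∀ j, a (k.succAbove j) = x j := fun j => congrFun hx j
  simp only [hx'] at *
  have hq : 4 ≤ ∑ j, (x j)^2 := by
    simpa using Finset.card_nsmul_le_sum univ (fun j => (x j)^2) 1 fun j _ => hone j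
  have hgap : 0 ≤ b * ∑ j, (x j)^2 - ∑ j, (x j)^3 := by
    rw [Finset.mul_sum, ← Finset.sum_sub_distrib]
    refine Finset.sum_nonneg fun j _ => ?_
    nlinarith [mul_nonneg (sq_nonneg (x j)) (sub_nonneg.mpr (hle j))]
  have heven : Even (∑ j, x j) := by
    rw [Fin.sum_univ_four]
    exact (((hodd' 0).add_odd (hodd' 1)).add_odd (hodd' 2)).add_odd (hodd' 3)
  have hsum : ∑ j, x j = 0 := by
    generalize ∑ j, x j = s at *
    have hs2 : ∑ j, (x j)^2 = 4 + s * (s + 2 * b) := by linear_combination hsq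
    have hs3 : ∑ j, (x j)^3 = s * (s^2 + 3 * s * b + 3 * b^2) := by
      linear_combination hcube
    rw [hs2] at hq hgap
    rw [hs3] at hgap
    obtain ⟨r, rfl⟩ := heven
    rcases lt_trichotomy r 0 with h | h | h
    · nlinarith
    · simp [h]
    · nlinarith [mul_pos (mul_pos h hbpos) hbpos, mul_pos h (mul_pos h hbpos), pow_pos h 3]
  rw [hsum] at hsq
  have hfour : ∑ j, (x j)^2 = 4 := by linarith
  have hunit : ∀ j, x j = 1 ∨ x j = -1 := by
    have h := (Finset.sum_eq_sum_iff_of_le (s := univ) (f := fun _ : Fin 4 => (1 : ℤ))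
      (g := fun j => (x j)^2) fun j _ => hone j).mp (by simp [hfour])
    exact fun j => sq_eq_one_iff.mp (h j (mem_univ j)).symm
  rw [Fin.sum_univ_four] at hsum
  by_contra! hne
  rcases hunit 0 with h0 | h0
  · have hall : ∀ j, x j = 1 := fun j => (hunit j).resolve_right (hne 0 j h0)
    simp [hall] at hsum
  · have hall : ∀ j, x j = -1 := fun j => (hunit j).resolve_left fun h => hne j 0 h h0
    simp [hall] at hsum

/-- Let `a₁,…,a₅` be odd integers with exactly two or exactly three negative
(and the rest positive), and `S = ∑ aᵢ`. If `∑ aᵢ² = S² + 4` and `∑ aᵢ³ = S³`,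
then either `∑ aᵢ² ≤ 8`, or there are indices `i, j` with `aᵢ = 1` and `aⱼ = -1`. -/
theorem fiveStrand_arith_core (a : Fin 5 → ℤ) (hodd : ∀ i, Odd (a i))
    (hsigns : ∀ i, a i < 0 ∨ 0 < a i)
    (hcard : (univ.filter (fun i => a i < 0)).card = 2 ∨
             (univ.filter (fun i => a i < 0)).card = 3)
    (hsq : ∑ i, (a i)^2 = (∑ i, a i)^2 + 4)
    (hcube : ∑ i, (a i)^3 = (∑ i, a i)^3) :
    (∑ i, (a i)^2 ≤ 8) ∨ (∃ i j, a i = 1 ∧ a j = -1) := by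
  right
  rcases lt_trichotomy (∑ i, a i) 0 with h | h | h
  · obtain ⟨i, j, hi, hj⟩ := exists_one_and_neg_one_of_sum_pos (fun i => -a i)
      (fun i => (hodd i).neg) (by simpa using hsq)
      (by simpa [Odd.neg_pow (by decide : Odd 3)] using hcube) (by simpa using h)
    exact ⟨j, i, by linarith, by linarith⟩
  · have : Odd (∑ i, a i) := by
      rw [Fin.sum_univ_five]
      exact ((((hodd 0).add_odd (hodd 1)).add_odd (hodd 2)).add_odd (hodd 3)).add_odd (hodd 4)
    simp [h] at this
  · exact exists_one_and_neg_one_of_sum_pos a hodd hsq hcube h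
end
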